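/- arXiv:1901.03078 — 6 statements merged into one kernel-verified Lean document; each statement's English description precedes it below -/
import Mathlib

section
/- Let N, D ∈ ℕ+ and let q ∈ ℕ with q ≥ 2. For all smooth N-periodic functions f, g : ℝ → ℂ one has | N⁻¹ ∫₀^N f(q t) · conj(g(t)) dt − α₀(f)·conj(α₀(g)) | ≤ (N/q)^D · ( Σ_{k∈ℤ} |α_k(f)|² )^{1/2} · ( Σ_{k∈ℤ} |α_k(g)|² (1 + |k|/N)^{2D} )^{1/2}. In particular, for fixed D the multiplication-by-q map on ℝ/Nℤ is exponentially mixing in q, with no hidden constant depending on q or N. -/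
/-!
Effective mixing of the multiplication-by-`q` map on `ℝ/Nℤ` at an arbitrary exponential
rate, with explicit constants.
-/

noncomputable section
open MeasureTheory

/-- The `k`-th Fourier coefficient of an `N`-periodic function `h : ℝ → ℂ`:
`α_k(h) = N⁻¹ ∫₀^N h(t) exp(−2πi k t/N) dt`. -/
def fCoeff (N : ℝ) (h : ℝ → ℂ) (k : ℤ) : ℂ :=
  (N : ℂ)⁻¹ * ∫ t in (0 : ℝ)..N,
    h t * Complex.exp (-(2 * Real.pi * Complex.I * (k : ℂ) * (t : ℂ) / (N : ℂ)))

/-- `fCoeff` is Mathlib's Fourier coefficient on the interval `[0, T]`. -/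
lemma fCoeff_eq_fourierCoeffOn {T : ℝ} (hT : 0 < T) (h : ℝ → ℂ) (k : ℤ) :
    fCoeff T h k = fourierCoeffOn hT h k := by
  rw [fourierCoeffOn_eq_integral, fCoeff, Complex.real_smul]
  congr 1
  · simp
  · refine intervalIntegral.integral_congr fun t _ => ?_
    simp only [fourier_coe_apply, smul_eq_mul, sub_zero]
    rw [mul_comm]
    congr 2
    push_cast
    ring

/-- Bessel: the Fourier coefficients of a continuous function are square summable. -/
lemma summable_sq_fCoeff {T : ℝ} (hT : 0 < T) {h : ℝ → ℂ} (hc : Continuous h) :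
    Summable fun k : ℤ => ‖fCoeff T h k‖ ^ 2 := by
  simp_rw [fCoeff_eq_fourierCoeffOn hT]
  refine (hasSum_sq_fourierCoeffOn hT ?_).summable
  obtain ⟨C, hC⟩ := isCompact_Icc.exists_bound_of_continuousOn (hc.continuousOn (s := Set.Icc 0 T))
  exact .of_bound hc.aestronglyMeasurable C
    ((ae_restrict_iff' measurableSet_Ioc).2 (.of_forall fun x hx => hC x ⟨hx.1.le, hx.2⟩))

/-- Differentiation multiplies the size of the `k`-th Fourier coefficient by at least `|k| / T`. -/
lemma abs_div_mul_norm_fCoeff_le {T : ℝ} (hT : 0 < T) {h : ℝ → ℂ} (hs : ContDiff ℝ 1 h)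
    (hp : Function.Periodic h T) (k : ℤ) :
    |(k : ℝ)| / T * ‖fCoeff T h k‖ ≤ ‖fCoeff T (deriv h) k‖ := by
  rcases eq_or_ne k 0 with rfl | hk
  · simp
  have hd : Continuous (deriv h) := hs.continuous_deriv le_rfl
  have key := fourierCoeffOn_of_hasDerivAt hT hk
    (fun x _ => (hs.differentiable one_ne_zero x).hasDerivAt) (hd.intervalIntegrable 0 T)
  have h0 : h T = h 0 := by simpa using hp 0
  rw [← fCoeff_eq_fourierCoeffOn, ← fCoeff_eq_fourierCoeffOn, h0] at key
  have hk' : 0 < |(k : ℝ)| := by positivity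
  have hnorm : ‖fCoeff T h k‖ = 1 / (2 * Real.pi * |(k : ℝ)|) * (T * ‖fCoeff T (deriv h) k‖) := by
    rw [key]
    simp [abs_of_pos hT, abs_of_pos Real.pi_pos]
  rw [hnorm]
  have hpi : 1 ≤ 2 * Real.pi := by linarith [Real.pi_gt_three]
  calc _ = ‖fCoeff T (deriv h) k‖ / (2 * Real.pi) := by field_simp
    _ ≤ _ := div_le_self (norm_nonneg _) hpi

lemma Function.Periodic.deriv_periodic {E : Type*} [NormedAddCommGroup E] [NormedSpace ℝ E]
    {h : ℝ → E} {T : ℝ} (hp : Function.Periodic h T) : Function.Periodic (deriv h) T := by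
  intro x
  rw [← deriv_comp_add_const, hp.funext]

lemma abs_div_pow_mul_norm_fCoeff_le {T : ℝ} (hT : 0 < T) (n : ℕ) {h : ℝ → ℂ}
    (hs : ContDiff ℝ (⊤ : ℕ∞) h) (hp : Function.Periodic h T) (k : ℤ) :
    (|(k : ℝ)| / T) ^ n * ‖fCoeff T h k‖ ≤ ‖fCoeff T (iteratedDeriv n h) k‖ := by
  induction n generalizing h with
  | zero => simp
  | succ n ih =>
    rw [iteratedDeriv_succ', pow_succ, mul_assoc]
    refine le_trans ?_ (ih (contDiff_infty_iff_deriv.1 hs).2 hp.deriv_periodic)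
    gcongr
    exact abs_div_mul_norm_fCoeff_le hT (hs.of_le (by exact_mod_cast le_top)) hp k

/-- The Fourier coefficients of a smooth periodic function are square summable against every
polynomial weight. -/
lemma summable_sq_fCoeff_mul_weight {T : ℝ} (hT : 0 < T) (n : ℕ) {h : ℝ → ℂ}
    (hs : ContDiff ℝ (⊤ : ℕ∞) h) (hp : Function.Periodic h T) :
    Summable fun k : ℤ => ‖fCoeff T h k‖ ^ 2 * (1 + |(k : ℝ)| / T) ^ (2 * n) := by
  have hd : Continuous (iteratedDeriv n h) :=
    hs.continuous_iteratedDeriv n (by exact_mod_cast le_top)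
  refine .of_nonneg_of_le (fun k => by positivity) (fun k => ?_)
    (((summable_sq_fCoeff hT hs.continuous).add (summable_sq_fCoeff hT hd)).mul_left
      (2 ^ (2 * n - 1)))
  have hx : 0 ≤ |(k : ℝ)| / T := by positivity
  have h1 := add_pow_le zero_le_one hx (2 * n)
  have h2 := pow_le_pow_left₀ (by positivity) (abs_div_pow_mul_norm_fCoeff_le hT n hs hp k) 2
  calc ‖fCoeff T h k‖ ^ 2 * (1 + |(k : ℝ)| / T) ^ (2 * n)
      ≤ ‖fCoeff T h k‖ ^ 2 * (2 ^ (2 * n - 1) * (1 ^ (2 * n) + (|(k : ℝ)| / T) ^ (2 * n))) := by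
        gcongr
    _ = 2 ^ (2 * n - 1) *
        (‖fCoeff T h k‖ ^ 2 + ((|(k : ℝ)| / T) ^ n * ‖fCoeff T h k‖) ^ 2) := by
        rw [one_pow, mul_pow, ← pow_mul, mul_comm n 2]; ring
    _ ≤ _ := by gcongr

lemma summable_fCoeff {T : ℝ} (hT : 0 < T) {h : ℝ → ℂ}
    (hs : ContDiff ℝ (⊤ : ℕ∞) h) (hp : Function.Periodic h T) :
    Summable fun k : ℤ => ‖fCoeff T h k‖ := by
  have hk : Summable fun k : ℤ => T ^ 2 * (1 / (k : ℝ) ^ 2) :=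
    (Real.summable_one_div_int_pow.2 one_lt_two).mul_left _
  refine .of_norm_bounded_eventually (hk.add (summable_sq_fCoeff_mul_weight hT 1 hs hp)) ?_
  filter_upwards [(Set.finite_singleton (0 : ℤ)).compl_mem_cofinite] with k hk0
  have hk0 : (k : ℝ) ≠ 0 := by simpa using hk0
  have hk' : 0 < |(k : ℝ)| := by positivity
  rw [norm_norm, ← sq_abs (k : ℝ), mul_one]
  set a := ‖fCoeff T h k‖
  have ha : 0 ≤ a := norm_nonneg _
  set x := |(k : ℝ)| / T with hx
  have hx0 : 0 < x := by positivity
  have hinv : T ^ 2 * (1 / |(k : ℝ)| ^ 2) = x⁻¹ ^ 2 := by rw [hx]; field_simp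
  rw [hinv]
  have h1 : a = x⁻¹ * (a * x) := by field_simp
  have h2 : a ^ 2 * x ^ 2 ≤ a ^ 2 * (1 + x) ^ 2 := by gcongr; linarith
  nlinarith [sq_nonneg (x⁻¹ - a * x), sq_nonneg (x⁻¹), sq_nonneg (a * x)]

/-- A smooth periodic function is the sum of its Fourier series. -/
lemma hasSum_fCoeff_mul_exp {T : ℝ} (hT : 0 < T) {h : ℝ → ℂ}
    (hs : ContDiff ℝ (⊤ : ℕ∞) h) (hp : Function.Periodic h T) (x : ℝ) :
    HasSum (fun k : ℤ => fCoeff T h k * Complex.exp (2 * Real.pi * Complex.I * k * x / T))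
      (h x) := by
  have : Fact (0 < T) := ⟨hT⟩
  let F : C(AddCircle T, ℂ) := ⟨hp.lift, hs.continuous.quotient_lift _⟩
  have hF (t : ℝ) : F t = h t := hp.lift_coe t
  have hcoeff (k : ℤ) : fourierCoeff F k = fCoeff T h k := by
    rw [fourierCoeff_eq_intervalIntegral _ _ 0, fCoeff, Complex.real_smul, zero_add]
    congr 1
    · simp
    · refine intervalIntegral.integral_congr fun t _ => ?_
      simp only [fourier_coe_apply, smul_eq_mul, hF]
      rw [mul_comm]
      congr 2
      push_cast
      ring
  have hsum : Summable (fourierCoeff F) := by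
    simp_rw [funext hcoeff]
    exact (summable_fCoeff hT hs hp).of_norm
  simpa only [hcoeff, hF, fourier_coe_apply, smul_eq_mul] using
    has_pointwise_sum_fourier_series_of_summable hsum (x : AddCircle T)

/-- The correlation of `f ∘ (q ·)` with `g` in terms of Fourier coefficients. -/
lemma hasSum_correlation {T : ℝ} (hT : 0 < T) (q : ℕ) {f g : ℝ → ℂ}
    (hf : ContDiff ℝ (⊤ : ℕ∞) f) (hfp : Function.Periodic f T) (hg : Continuous g) :
    HasSum (fun k : ℤ => fCoeff T f k * (starRingEnd ℂ) (fCoeff T g (q * k)))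
      ((T : ℂ)⁻¹ * ∫ t in (0 : ℝ)..T, f (q * t) * (starRingEnd ℂ) (g t)) := by
  have hterm (k : ℤ) : fCoeff T f k * (starRingEnd ℂ) (fCoeff T g (q * k)) =
      (T : ℂ)⁻¹ * ∫ t in (0 : ℝ)..T, fCoeff T f k *
        Complex.exp (2 * Real.pi * Complex.I * k * (q * t : ℝ) / T) * (starRingEnd ℂ) (g t) := by
    simp_rw [mul_assoc (fCoeff T f k)]
    rw [intervalIntegral.integral_const_mul, fCoeff.eq_def T g, map_mul,
      ← intervalIntegral.intervalIntegral_conj, mul_left_comm]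
    congr 1
    · simp
    · congr 1
      refine intervalIntegral.integral_congr fun t _ => ?_
      simp only [map_mul, ← Complex.exp_conj]
      rw [mul_comm]
      congr 2
      simp [Complex.conj_ofNat]
      ring
  simp_rw [hterm]
  refine HasSum.mul_left _ ?_
  refine intervalIntegral.hasSum_integral_of_dominated_convergence
    (fun k t => ‖fCoeff T f k‖ * ‖g t‖) (fun k => ?_) (fun k => ?_) ?_ ?_ ?_
  · exact Continuous.aestronglyMeasurable (by fun_prop)
  · refine .of_forall fun t _ => ?_
    have : ‖Complex.exp (2 * Real.pi * Complex.I * k * (q * t : ℝ) / T)‖ = 1 := by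
      rw [← Complex.norm_exp_ofReal_mul_I (2 * Real.pi * k * (q * t) / T)]
      congr 2
      push_cast
      ring
    rw [norm_mul, norm_mul, this, mul_one, RCLike.norm_conj]
  · exact .of_forall fun t _ => (summable_fCoeff hT hf hfp).mul_right _
  · simp_rw [tsum_mul_right]
    exact Continuous.intervalIntegrable (by fun_prop) _ _
  · exact .of_forall fun t _ => (hasSum_fCoeff_mul_exp hT hf hfp (q * t)).mul_right _

/-- Cauchy–Schwarz for square-summable families. -/
lemma summable_and_tsum_mul_le_sqrt_mul_sqrt {ι : Type*} {a b : ι → ℝ} (ha : ∀ i, 0 ≤ a i)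
    (hb : ∀ i, 0 ≤ b i) (hsa : Summable fun i => a i ^ 2) (hsb : Summable fun i => b i ^ 2) :
    (Summable fun i => a i * b i) ∧
      ∑' i, a i * b i ≤ √(∑' i, a i ^ 2) * √(∑' i, b i ^ 2) := by
  simpa [Real.sqrt_eq_rpow] using Real.summable_and_inner_le_Lp_mul_Lq_tsum_of_nonneg
    Real.HolderConjugate.two_two ha hb (by simpa using hsa) (by simpa using hsb)

/-- Let `N, D ∈ ℕ+` and `q ≥ 2`.  For all smooth `N`-periodic
`f, g : ℝ → ℂ`,
`|N⁻¹ ∫₀^N f(qt) conj(g(t)) dt − α₀(f) conj(α₀(g))|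
  ≤ (N/q)^D (∑_k |α_k(f)|²)^{1/2} (∑_k |α_k(g)|² (1+|k|/N)^{2D})^{1/2}`;
in particular the multiplication-by-`q` map on `ℝ/Nℤ` is exponentially mixing in `q`, with
no hidden constant depending on `q` or `N`. -/
theorem expanding_map_effective_mixing_circle (N D : ℕ+) (q : ℕ) (hq : 2 ≤ q)
    (f g : ℝ → ℂ) (hf : ContDiff ℝ (⊤ : ℕ∞) f) (hg : ContDiff ℝ (⊤ : ℕ∞) g)
    (hfp : Function.Periodic f ((N : ℕ) : ℝ)) (hgp : Function.Periodic g ((N : ℕ) : ℝ)) :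
    ‖(((N : ℕ) : ℂ))⁻¹ *
        (∫ t in (0 : ℝ)..((N : ℕ) : ℝ), f ((q : ℝ) * t) * (starRingEnd ℂ) (g t)) -
        fCoeff ((N : ℕ) : ℝ) f 0 * (starRingEnd ℂ) (fCoeff ((N : ℕ) : ℝ) g 0)‖ ≤
      (((N : ℕ) : ℝ) / (q : ℝ)) ^ (D : ℕ) *
        Real.sqrt (∑' k : ℤ, ‖fCoeff ((N : ℕ) : ℝ) f k‖ ^ 2) *
        Real.sqrt (∑' k : ℤ,
          ‖fCoeff ((N : ℕ) : ℝ) g k‖ ^ 2 * (1 + |(k : ℝ)| / ((N : ℕ) : ℝ)) ^ (2 * (D : ℕ))) := by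
  have hT : (0 : ℝ) < ((N : ℕ) : ℝ) := by exact_mod_cast N.pos
  rw [← Complex.ofReal_natCast (N : ℕ)]
  generalize ((N : ℕ) : ℝ) = T at *
  have hq0 : (0 : ℝ) < q := by exact_mod_cast (by omega : 0 < q)
  generalize (D : ℕ) = n
  set w : ℤ → ℝ := fun k => (1 + |(k : ℝ)| / T) ^ n with hw
  have hw0 (k : ℤ) : 0 ≤ w k := by positivity
  have hwsq (k : ℤ) : ‖fCoeff T g k‖ ^ 2 * (1 + |(k : ℝ)| / T) ^ (2 * n) =
      (‖fCoeff T g k‖ * w k) ^ 2 := by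
    rw [mul_pow, ← pow_mul, mul_comm n 2]
  have hsf := summable_sq_fCoeff hT hf.continuous
  have hsg := summable_sq_fCoeff_mul_weight hT n hg hgp
  simp_rw [hwsq] at hsg ⊢
  have hinj : Function.Injective fun k : ℤ => (q : ℤ) * k :=
    mul_right_injective₀ (by omega)
  obtain ⟨hs, hle⟩ := summable_and_tsum_mul_le_sqrt_mul_sqrt
    (fun k : ℤ => norm_nonneg (fCoeff T f k))
    (fun k : ℤ => mul_nonneg (norm_nonneg (fCoeff T g (q * k))) (hw0 (q * k)))
    hsf (hsg.comp_injective hinj)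
  have hterm (k : ℤ) :
      ‖if k = 0 then 0 else fCoeff T f k * (starRingEnd ℂ) (fCoeff T g (q * k))‖ ≤
      (T / q) ^ n * (‖fCoeff T f k‖ * (‖fCoeff T g (q * k)‖ * w (q * k))) := by
    rcases eq_or_ne k 0 with rfl | hk
    · rw [if_pos rfl, norm_zero]
      exact mul_nonneg (by positivity)
        (mul_nonneg (norm_nonneg _) (mul_nonneg (norm_nonneg _) (hw0 _)))
    · have hk1 : (1 : ℝ) ≤ |(k : ℝ)| := by exact_mod_cast Int.one_le_abs hk
      have hone : 1 ≤ (T / q) ^ n * w (q * k) := by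
        rw [hw, ← mul_pow]
        refine one_le_pow₀ ?_
        push_cast
        rw [abs_mul, Nat.abs_cast]
        have : T / q * (1 + q * |(k : ℝ)| / T) = T / q + |(k : ℝ)| := by field_simp
        rw [this]
        linarith [div_pos hT hq0]
      rw [if_neg hk, norm_mul, RCLike.norm_conj]
      calc ‖fCoeff T f k‖ * ‖fCoeff T g (q * k)‖
          ≤ ‖fCoeff T f k‖ * ‖fCoeff T g (q * k)‖ * ((T / q) ^ n * w (q * k)) :=
            le_mul_of_one_le_right (by positivity) hone
        _ = _ := by ring
  have hsum := hasSum_ite_sub_hasSum (hasSum_correlation hT q hf hfp hg.continuous) 0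
  rw [mul_zero] at hsum
  refine (hsum.norm_le_of_bounded (hs.mul_left _).hasSum hterm).trans ?_
  rw [tsum_mul_left, mul_assoc]
  gcongr
  refine hle.trans ?_
  exact mul_le_mul_of_nonneg_left
    (Real.sqrt_le_sqrt (tsum_comp_le_tsum_of_inj hsg (fun k => sq_nonneg _) hinj))
    (Real.sqrt_nonneg _)

end
end

section
/- Let P be a finite set of primes. (i) Every g ∈ G = SL₂(ℝ) × ∏_{p∈P} SL₂(ℚ_p) can be written as g = Δ(γ)·h with γ ∈ SL₂(ℤ[1/P]) and h ∈ SL₂(ℝ) × ∏_{p∈P} SL₂(ℤ_p). (ii) For γ ∈ SL₂(ℤ[1/P]), the diagonal embedding Δ(γ) lies in SL₂(ℝ) × ∏_{p∈P} SL₂(ℤ_p) if and only if all entries of γ lie in ℤ, i.e. γ ∈ SL₂(ℤ). Equivalently, SL₂(ℝ) × ∏_{p∈P} SL₂(ℤ_p) acts transitively on the space of right cosets Δ(SL₂(ℤ[1/P]))\G, and the stabilizer of the identity coset is SL₂(ℤ). -/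
/-!
`SL₂` over `ℚ` has class number one: `G = SL₂(ℝ) × ∏_{p∈P} SL₂(ℚ_p)` decomposes as
`Δ(SL₂(ℤ[1/P])) · (SL₂(ℝ) × ∏_{p∈P} SL₂(ℤ_p))`, and the corresponding stabilizer of the
identity coset is `SL₂(ℤ)`.
-/

set_option linter.unusedSectionVars false

noncomputable section
open MeasureTheory Matrix

instance (p : ℕ) [Fact p.Prime] : MeasurableSpace ℚ_[p] := borel _
instance (p : ℕ) [Fact p.Prime] : BorelSpace ℚ_[p] := ⟨rfl⟩

instance (p : ℕ) [Fact p.Prime] : MeasurableSpace (Matrix (Fin 2) (Fin 2) ℚ_[p]) :=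
  inferInstanceAs (MeasurableSpace ((Fin 2) → (Fin 2) → ℚ_[p]))

instance (p : ℕ) [Fact p.Prime] :
    MeasurableSpace (Matrix.SpecialLinearGroup (Fin 2) ℚ_[p]) :=
  inferInstanceAs (MeasurableSpace {A : Matrix (Fin 2) (Fin 2) ℚ_[p] // A.det = 1})

instance : MeasurableSpace (Matrix (Fin 2) (Fin 2) ℝ) :=
  inferInstanceAs (MeasurableSpace ((Fin 2) → (Fin 2) → ℝ))

instance : MeasurableSpace (Matrix.SpecialLinearGroup (Fin 2) ℝ) :=
  inferInstanceAs (MeasurableSpace {A : Matrix (Fin 2) (Fin 2) ℝ // A.det = 1})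


instance (p : ℕ) [Fact p.Prime] :
    TopologicalSpace (Matrix.SpecialLinearGroup (Fin 2) ℚ_[p]) :=
  inferInstanceAs (TopologicalSpace {A : Matrix (Fin 2) (Fin 2) ℚ_[p] // A.det = 1})

instance : TopologicalSpace (Matrix.SpecialLinearGroup (Fin 2) ℝ) :=
  inferInstanceAs (TopologicalSpace {A : Matrix (Fin 2) (Fin 2) ℝ // A.det = 1})

variable (P : Finset ℕ) [∀ p : ↥P, Fact (Nat.Prime (p : ℕ))]

/-- `ℚ_P = ℝ × ∏_{p ∈ P} ℚ_p`. -/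
abbrev QP : Type := ℝ × ((p : ↥P) → ℚ_[(p : ℕ)])

/-- The subring `ℤ[1/P] ⊆ ℚ` generated by `ℤ` and the inverses of the primes in `P`. -/
def ZinvP : Subring ℚ := Subring.closure {x : ℚ | ∃ p ∈ P, x = ((p : ℚ))⁻¹}

/-- The diagonal embedding `ℚ → ℚ_P`. -/
def ratDiag : ℚ →+* QP P :=
  RingHom.prod (Rat.castHom ℝ) (Pi.ringHom fun p => Rat.castHom ℚ_[(p : ℕ)])

/-- The lattice `Δ(ℤ[1/P]) ⊆ ℚ_P`. -/
def latP : AddSubgroup (QP P) :=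
  (((ratDiag P).comp (ZinvP P).subtype).toAddMonoidHom).range

/-- The solenoid `𝕋_P = ℚ_P / Δ(ℤ[1/P])`. -/
abbrev TP := QP P ⧸ latP P

/-- `G = SL₂(ℝ) × ∏_{p ∈ P} SL₂(ℚ_p)`. -/
abbrev GP : Type :=
  Matrix.SpecialLinearGroup (Fin 2) ℝ ×
    ((p : ↥P) → Matrix.SpecialLinearGroup (Fin 2) ℚ_[(p : ℕ)])

/-- The diagonal embedding `SL₂(ℚ) → G`. -/
def sl2Diag : Matrix.SpecialLinearGroup (Fin 2) ℚ →* GP P :=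
  MonoidHom.prod (Matrix.SpecialLinearGroup.map (Rat.castHom ℝ))
    (Pi.monoidHom fun p => Matrix.SpecialLinearGroup.map (Rat.castHom ℚ_[(p : ℕ)]))

/-- The lattice `Δ(SL₂(ℤ[1/P])) ⊆ G`. -/
def ΓP : Subgroup (GP P) :=
  ((sl2Diag P).comp (Matrix.SpecialLinearGroup.map (ZinvP P).subtype)).range


theorem natCast_inv_mem_ZinvP {p : ℕ} (hp : p ∈ P) : ((p : ℚ))⁻¹ ∈ ZinvP P :=
  Subring.subset_closure ⟨p, hp, rfl⟩

theorem prod_inv_mem_ZinvP : ((∏ p ∈ P, p : ℕ) : ℚ)⁻¹ ∈ ZinvP P := by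
  rw [Nat.cast_prod, ← Finset.prod_inv_distrib]
  exact Subring.prod_mem _ fun p hp => natCast_inv_mem_ZinvP P hp

/-- Elements of `ℤ[1/P]` are `ℓ`-integral for every prime `ℓ ∉ P`. -/
theorem padic_norm_le_one_of_mem_ZinvP {l : ℕ} [Fact l.Prime] (hl : l ∉ P) {q : ℚ}
    (hq : q ∈ ZinvP P) : ‖(q : ℚ_[l])‖ ≤ 1 := by
  have h : ZinvP P ≤ (PadicInt.subring l).comap (Rat.castHom ℚ_[l]) := by
    refine Subring.closure_le.2 ?_
    rintro _ ⟨p, hp, rfl⟩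
    have hpp : p.Prime := (inferInstance : Fact (Nat.Prime ((⟨p, hp⟩ : ↥P) : ℕ))).out
    change ‖(((p : ℚ)⁻¹ : ℚ) : ℚ_[l])‖ ≤ 1
    refine Padic.norm_rat_le_one ?_
    rw [Rat.inv_natCast_den_of_pos hpp.pos, Nat.prime_dvd_prime_iff_eq Fact.out hpp]
    rintro rfl
    exact hl hp
  exact h hq

/-- A rational number that is `ℓ`-integral at every prime `ℓ` is an integer. -/
theorem exists_eq_intCast_of_padic_norm_le_one {q : ℚ}
    (hq : ∀ (l : ℕ) [Fact l.Prime], ‖(q : ℚ_[l])‖ ≤ 1) : ∃ z : ℤ, q = z := by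
  refine ⟨q.num, ((Rat.den_eq_one_iff q).1 ?_).symm⟩
  refine Nat.eq_one_iff_not_exists_prime_dvd.2 fun l hl hdvd => ?_
  have : Fact l.Prime := ⟨hl⟩
  have h := PadicInt.isUnit_iff.1 (PadicInt.isUnit_den q (hq l))
  exact (hl.coprime_iff_not_dvd.1 (by simpa using h)) hdvd

/-- Weak approximation by integers at finitely many primes. -/
theorem exists_nat_norm_sub_padicInt_lt (y : (p : ↥P) → ℤ_[(p : ℕ)]) (ε : ↥P → ℝ)
    (hε : ∀ p, 0 < ε p) : ∃ n : ℕ, ∀ p, ‖y p - (n : ℤ_[(p : ℕ)])‖ < ε p := by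
  have h1 : ∀ p : ↥P, ∃ n : ℕ, ‖y p - (n : ℤ_[(p : ℕ)])‖ < ε p := fun p => by
    obtain ⟨n, hn⟩ := PadicInt.denseRange_natCast.exists_dist_lt (y p) (hε p)
    exact ⟨n, by rwa [dist_eq_norm] at hn⟩
  choose a ha using h1
  have h2 : ∀ p : ↥P, ∃ m : ℕ, ((p : ℕ) : ℝ) ^ (-(m : ℤ)) < ε p := fun p =>
    PadicInt.exists_pow_neg_lt _ (hε p)
  choose m hm using h2
  obtain ⟨n, hn⟩ := Nat.chineseRemainderOfFinset a (fun p : ↥P => (p : ℕ) ^ m p) Finset.univ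
    (fun p _ => pow_ne_zero _ (Fact.out : Nat.Prime (p : ℕ)).ne_zero)
    (fun p _ q _ hpq => Nat.coprime_pow_primes _ _ Fact.out Fact.out
      fun h => hpq (Subtype.ext h))
  refine ⟨n, fun p => ?_⟩
  have h3 : ‖(a p : ℤ_[(p : ℕ)]) - n‖ < ε p := by
    refine lt_of_le_of_lt ?_ (hm p)
    have h4 := (PadicInt.norm_int_le_pow_iff_dvd (p := (p : ℕ)) (k := (a p : ℤ) - n)
      (n := m p)).2 (by exact_mod_cast (Nat.modEq_iff_dvd.1 (hn p (Finset.mem_univ p))))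
    simpa using h4
  calc ‖y p - (n : ℤ_[(p : ℕ)])‖ = ‖(y p - a p) + ((a p : ℤ_[(p : ℕ)]) - n)‖ := by
        rw [sub_add_sub_cancel]
    _ ≤ max ‖y p - a p‖ ‖(a p : ℤ_[(p : ℕ)]) - n‖ := PadicInt.nonarchimedean _ _
    _ < ε p := max_lt (ha p) h3

/-- `ℤ[1/P]` is dense in `∏_{p ∈ P} ℚ_p`. -/
theorem denseRange_ZinvP :
    DenseRange fun (q : ZinvP P) (p : ↥P) => ((q : ℚ) : ℚ_[(p : ℕ)]) := by
  intro x
  rw [Metric.mem_closure_range_iff]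
  intro ε hε
  set N : ℕ := ∏ p ∈ P, p
  have hN0 : N ≠ 0 := Finset.prod_ne_zero_iff.2 fun p hp =>
    (inferInstance : Fact (Nat.Prime ((⟨p, hp⟩ : ↥P) : ℕ))).out.ne_zero
  have hNp : ∀ p : ↥P, (N : ℚ_[(p : ℕ)]) ≠ 0 := fun p => Nat.cast_ne_zero.2 hN0
  have hk : ∃ k : ℕ, ∀ p : ↥P, ‖(N : ℚ_[(p : ℕ)]) ^ k * x p‖ ≤ 1 := by
    refine (Filter.eventually_all.2 fun p : ↥P => ?_).exists (f := Filter.atTop)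
    have hlt : ‖(N : ℚ_[(p : ℕ)])‖ < 1 :=
      (Padic.norm_natCast_lt_one_iff).2 (Finset.dvd_prod_of_mem _ p.2)
    have ht := (tendsto_pow_atTop_nhds_zero_of_norm_lt_one hlt).mul_const (x p)
    rw [zero_mul] at ht
    filter_upwards [ht.norm.eventually_lt_const (u := 1) (by simp)] with k hk using hk.le
  obtain ⟨k, hk⟩ := hk
  have hy : ∀ p : ↥P, ∃ y : ℤ_[(p : ℕ)], (y : ℚ_[(p : ℕ)]) = (N : ℚ_[(p : ℕ)]) ^ k * x p :=
    fun p => ⟨⟨_, hk p⟩, rfl⟩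
  choose y hy using hy
  obtain ⟨n, hn⟩ := exists_nat_norm_sub_padicInt_lt P y (fun p => ‖(N : ℚ_[(p : ℕ)]) ^ k‖ * ε)
    (fun p => mul_pos (norm_pos_iff.2 (pow_ne_zero _ (hNp p))) hε)
  refine ⟨⟨(n : ℚ) * ((N : ℚ)⁻¹) ^ k, (ZinvP P).mul_mem (natCast_mem _ n)
    (pow_mem (prod_inv_mem_ZinvP P) k)⟩, (dist_pi_lt_iff hε).2 fun p => ?_⟩
  have h := hn p
  rw [PadicInt.norm_def, PadicInt.coe_sub, PadicInt.coe_natCast, hy] at h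
  refine lt_of_mul_lt_mul_left (a := ‖(N : ℚ_[(p : ℕ)]) ^ k‖) ?_ (norm_nonneg _)
  rw [dist_eq_norm, ← norm_mul]
  have hN1 : (N : ℚ_[(p : ℕ)]) ^ k * ((N : ℚ_[(p : ℕ)])⁻¹) ^ k = 1 := by
    rw [← mul_pow, mul_inv_cancel₀ (hNp p), one_pow]
  convert h using 2
  congr 1
  push_cast
  linear_combination (-(n : ℚ_[(p : ℕ)])) * hN1

/-- The product of elementary matrices
`(1 x; 0 1) (1 0; y 1) (1 z; 0 1) (1 0; w 1)` in `SL₂(R)`. -/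
def elementaryProduct {R : Type*} [CommRing R] (v : R × R × R × R) :
    Matrix.SpecialLinearGroup (Fin 2) R :=
  ⟨!![1, v.1; 0, 1] * !![1, 0; v.2.1, 1] * !![1, v.2.2.1; 0, 1] * !![1, 0; v.2.2.2, 1],
    by simp only [Matrix.det_mul, Matrix.det_fin_two_of]; ring⟩

theorem coe_elementaryProduct {R : Type*} [CommRing R] (v : R × R × R × R) :
    (elementaryProduct v : Matrix (Fin 2) (Fin 2) R) =
      !![1, v.1; 0, 1] * !![1, 0; v.2.1, 1] * !![1, v.2.2.1; 0, 1] * !![1, 0; v.2.2.2, 1] :=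
  rfl

theorem map_elementaryProduct {R S : Type*} [CommRing R] [CommRing S] (f : R →+* S)
    (v : R × R × R × R) : Matrix.SpecialLinearGroup.map f (elementaryProduct v) =
      elementaryProduct (f v.1, f v.2.1, f v.2.2.1, f v.2.2.2) := by
  ext i j
  fin_cases i <;> fin_cases j <;>
    simp [Matrix.SpecialLinearGroup.map_apply_coe, coe_elementaryProduct]

/-- Over a field every element of `SL₂` is a product of four elementary matrices. -/
theorem elementaryProduct_surjective {K : Type*} [Field K] :
    Function.Surjective (elementaryProduct : K × K × K × K → _) := by
  have key : ∀ a b c d w : K, a * d - b * c = 1 → c - d * w ≠ 0 →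
      ∃ v : K × K × K × K, (elementaryProduct v : Matrix (Fin 2) (Fin 2) K) = !![a, b; c, d] := by
    intro a b c d w hdet hc
    obtain ⟨x, hx⟩ : ∃ x, x * (c - d * w) = a - b * w - 1 := ⟨_, div_mul_cancel₀ _ hc⟩
    obtain ⟨z, hz⟩ : ∃ z, (c - d * w) * z = d - 1 := ⟨_, mul_div_cancel₀ _ hc⟩
    have hb : (1 + x * (c - d * w)) * z + x = b := by
      refine mul_left_cancel₀ hc ?_
      linear_combination (1 + x * (c - d * w)) * hz + d * hx + hdet
    refine ⟨(x, c - d * w, z, w), ?_⟩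
    rw [coe_elementaryProduct]
    ext i j
    fin_cases i <;> fin_cases j <;> simp
    · linear_combination hx + w * hb
    · linear_combination hb
    · linear_combination w * hz
    · linear_combination hz
  intro g
  have hdet := g.det_coe
  rw [Matrix.det_fin_two] at hdet
  have hw : ∃ w : K, g 1 0 - g 1 1 * w ≠ 0 := by
    by_cases h : g 1 0 = 0
    · refine ⟨1, fun h' => ?_⟩
      rw [h, zero_sub, mul_one, neg_eq_zero] at h'
      rw [h, h'] at hdet
      simp at hdet
    · exact ⟨0, by simpa using h⟩
  obtain ⟨w, hw⟩ := hw
  obtain ⟨v, hv⟩ := key _ _ _ _ w hdet hw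
  exact ⟨v, Subtype.ext (hv.trans (Matrix.eta_fin_two _).symm)⟩

/-- Some element of `SL₂(ℤ[1/P])` moves a given `g ∈ ∏_{p ∈ P} SL₂(ℚ_p)` into
`∏_{p ∈ P} SL₂(ℤ_p)`. -/
theorem exists_ZinvP_mul_integral
    (g : (p : ↥P) → Matrix.SpecialLinearGroup (Fin 2) ℚ_[(p : ℕ)]) :
    ∃ γ : Matrix.SpecialLinearGroup (Fin 2) (ZinvP P), ∀ (p : ↥P) (i j : Fin 2),
      ‖((Matrix.SpecialLinearGroup.map ((Rat.castHom ℚ_[(p : ℕ)]).comp (ZinvP P).subtype) γ *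
        g p : Matrix.SpecialLinearGroup (Fin 2) ℚ_[(p : ℕ)]) :
          Matrix (Fin 2) (Fin 2) ℚ_[(p : ℕ)]) i j‖ ≤ 1 := by
  choose v hv using fun p => elementaryProduct_surjective (g p)⁻¹
  let X := (p : ↥P) → ℚ_[(p : ℕ)]
  let F : (p : ↥P) → X × X × X × X → Matrix (Fin 2) (Fin 2) ℚ_[(p : ℕ)] := fun p x =>
    (elementaryProduct (x.1 p, x.2.1 p, x.2.2.1 p, x.2.2.2 p) * g p :
      Matrix.SpecialLinearGroup (Fin 2) ℚ_[(p : ℕ)])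
  have hF : ∀ p, Continuous (F p) := fun p => by
    refine continuous_matrix fun i j => ?_
    fin_cases i <;> fin_cases j <;>
      simp only [F, Matrix.SpecialLinearGroup.coe_mul, coe_elementaryProduct, Matrix.mul_fin_two, Matrix.mul_apply,
        Fin.sum_univ_two] <;> simp <;> fun_prop
  let U : Set (X × X × X × X) := {x | ∀ p i j, F p x i j ∈ Metric.closedBall 0 1}
  have hU : IsOpen U := by
    simp only [U, Set.ofPred_forall]
    exact isOpen_iInter_of_finite fun p => isOpen_iInter_of_finite fun i =>
      isOpen_iInter_of_finite fun j =>
        (IsUltrametricDist.isOpen_closedBall 0 one_ne_zero).preimage ((hF p).matrix_elem i j)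
  have hUne : U.Nonempty := by
    refine ⟨(fun p => (v p).1, fun p => (v p).2.1, fun p => (v p).2.2.1,
      fun p => (v p).2.2.2), fun p i j => ?_⟩
    have h1 : F p (fun p => (v p).1, fun p => (v p).2.1, fun p => (v p).2.2.1,
        fun p => (v p).2.2.2) = 1 := by
      change ((elementaryProduct (v p) * g p :
        Matrix.SpecialLinearGroup (Fin 2) ℚ_[(p : ℕ)]) :
          Matrix (Fin 2) (Fin 2) ℚ_[(p : ℕ)]) = 1
      rw [hv, inv_mul_cancel, Matrix.SpecialLinearGroup.coe_one]
    rw [h1, Matrix.one_apply]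
    split_ifs <;> simp
  have hd := denseRange_ZinvP P
  obtain ⟨q, hq⟩ := (hd.prodMap (hd.prodMap (hd.prodMap hd))).exists_mem_open hU hUne
  refine ⟨elementaryProduct q, fun p i j => ?_⟩
  rw [map_elementaryProduct]
  exact mem_closedBall_zero_iff.1 (hq p i j)

/-- (i) Every `g ∈ G = SL₂(ℝ) × ∏_{p∈P} SL₂(ℚ_p)` can be written as
`g = Δ(γ)·h` with `γ ∈ SL₂(ℤ[1/P])` and `h ∈ SL₂(ℝ) × ∏_{p∈P} SL₂(ℤ_p)`.
(ii) For `γ ∈ SL₂(ℤ[1/P])`, the diagonal embedding `Δ(γ)` lies in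
`SL₂(ℝ) × ∏_{p∈P} SL₂(ℤ_p)` if and only if all entries of `γ` are integers.  (Membership
of a `p`-component in `SL₂(ℤ_p)` is expressed by all its entries having `p`-adic norm at
most `1`.) -/
theorem class_number_one_decomposition :
    (∀ g : GP P, ∃ γ : Matrix.SpecialLinearGroup (Fin 2) ℚ,
        (∀ i j : Fin 2, (γ : Matrix (Fin 2) (Fin 2) ℚ) i j ∈ ZinvP P) ∧
        ∃ h : GP P,
          (∀ (p : ↥P) (i j : Fin 2),
            ‖((h.2 p : Matrix (Fin 2) (Fin 2) ℚ_[(p : ℕ)])) i j‖ ≤ 1) ∧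
          g = sl2Diag P γ * h) ∧
      (∀ γ : Matrix.SpecialLinearGroup (Fin 2) ℚ,
        (∀ i j : Fin 2, (γ : Matrix (Fin 2) (Fin 2) ℚ) i j ∈ ZinvP P) →
        ((∀ (p : ↥P) (i j : Fin 2),
            ‖((((sl2Diag P γ).2 p) : Matrix (Fin 2) (Fin 2) ℚ_[(p : ℕ)])) i j‖ ≤ 1) ↔
          ∀ i j : Fin 2, ∃ z : ℤ, (γ : Matrix (Fin 2) (Fin 2) ℚ) i j = (z : ℚ))) := by
  refine ⟨fun g => ?_, fun γ hγ => ⟨fun h i j => ?_, fun h p i j => ?_⟩⟩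
  · obtain ⟨γ, hγ⟩ := exists_ZinvP_mul_integral P g.2
    refine ⟨Matrix.SpecialLinearGroup.map (ZinvP P).subtype γ⁻¹, fun i j => (γ⁻¹ i j).2,
      sl2Diag P (Matrix.SpecialLinearGroup.map (ZinvP P).subtype γ) * g, hγ, ?_⟩
    rw [← mul_assoc, ← map_mul, ← map_mul, inv_mul_cancel, map_one, map_one, one_mul]
  · refine exists_eq_intCast_of_padic_norm_le_one fun l _ => ?_
    by_cases hl : l ∈ P
    · exact h ⟨l, hl⟩ i j
    · exact padic_norm_le_one_of_mem_ZinvP P hl (hγ i j)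
  · obtain ⟨z, hz⟩ := h i j
    change ‖((γ i j : ℚ) : ℚ_[(p : ℕ)])‖ ≤ 1
    rw [hz, Rat.cast_intCast]
    exact Padic.norm_int_le_one z

end
end

section
/- Let P be a finite set of primes and G = SL₂(ℝ) × ∏_{p∈P} SL₂(ℚ_p). For y = (y_∞, (y_p)_{p∈P}) with y_∞ ∈ ℝ, y_∞ > 0, and y_p ∈ ℤ_pˣ for every p ∈ P, let a_y ∈ G be the element whose ∞-component is [[y_∞, 0],[0, 1/y_∞]] and whose p-component is [[y_p, 0],[0, y_p⁻¹]], and let U = { u_t : t ∈ ℝ × ∏_{p∈P} ℚ_p } where u_t has components [[1, t_v],[0, 1]]. If y and z are two such tuples and the sets Δ(SL₂(ℤ[1/P]))·a_y·U and Δ(SL₂(ℤ[1/P]))·a_z·U coincide in the coset space Δ(SL₂(ℤ[1/P]))\G, then y = z. (This is the injectivity of the parametrization y ↦ 𝒰_y of periodic horocycle orbits by ℝ_{>0} × ∏_{p∈P} ℤ_pˣ.) -/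
/-!
Injectivity of the parametrization `y ↦ 𝒰_y = Δ(SL₂(ℤ[1/P]))·a_y·U` of periodic horocycle
orbits by `ℝ_{>0} × ∏_{p∈P} ℤ_pˣ`.
-/

set_option linter.unusedSectionVars false

noncomputable section
open MeasureTheory Matrix

variable (P : Finset ℕ) [∀ p : ↥P, Fact (Nat.Prime (p : ℕ))]

/-- The unipotent `[[1, t], [0, 1]]` over any commutative ring. -/
def uF {K : Type*} [CommRing K] (t : K) : Matrix.SpecialLinearGroup (Fin 2) K :=
  ⟨!![1, t; 0, 1], by simp [Matrix.det_fin_two_of]⟩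

/-- The diagonal `[[y, 0], [0, y⁻¹]]` over any field (junk value `1` for `y = 0`). -/
def aDiagF {K : Type*} [Field K] (y : K) : Matrix.SpecialLinearGroup (Fin 2) K :=
  letI := Classical.dec (y = 0)
  if h : y = 0 then 1
  else ⟨!![y, 0; 0, y⁻¹], by simp [Matrix.det_fin_two_of, mul_inv_cancel₀ h]⟩

/-- The diagonal element `a_y ∈ G` attached to `y = (y_∞, (y_p)_p)`. -/
def aY (y₁ : ℝ) (y₂ : (p : ↥P) → ℚ_[(p : ℕ)]) : GP P :=
  (aDiagF y₁, fun p => aDiagF (y₂ p))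

/-- The horospherical element `u_t ∈ G` attached to `t ∈ ℚ_P`. -/
def uT (t : QP P) : GP P := (uF t.1, fun p => uF (t.2 p))

/-- A rational that is integral at every prime is an integer. -/
theorem Rat.exists_int_eq_of_forall_padic_norm_le_one {q : ℚ}
    (h : ∀ (ℓ : ℕ) [Fact ℓ.Prime], ‖(q : ℚ_[ℓ])‖ ≤ 1) : ∃ n : ℤ, (n : ℚ) = q := by
  refine ⟨q.num, Rat.coe_int_num_of_den_eq_one ?_⟩
  by_contra hden
  obtain ⟨ℓ, hℓ, hdvd⟩ := Nat.exists_prime_and_dvd hden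
  have : Fact ℓ.Prime := ⟨hℓ⟩
  exact (Rat.padicValuation_le_one_iff.mp
    ((Padic.norm_rat_le_one_iff_padicValuation_le_one ℓ).mp (h ℓ))) hdvd

/-- Elements of `ℤ[1/P]` are integral at every prime outside `P`. -/
theorem ZinvP.padic_norm_le_one {P : Finset ℕ} [∀ p : ↥P, Fact (Nat.Prime (p : ℕ))] {q : ℚ}
    (hq : q ∈ ZinvP P) {ℓ : ℕ} [Fact ℓ.Prime] (hℓ : ℓ ∉ P) : ‖(q : ℚ_[ℓ])‖ ≤ 1 := by
  have hle : ZinvP P ≤ (PadicInt.subring ℓ).comap (Rat.castHom ℚ_[ℓ]) := by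
    refine Subring.closure_le.mpr ?_
    rintro _ ⟨p, hp, rfl⟩
    have hprime : p.Prime := (inferInstance : Fact (((⟨p, hp⟩ : ↥P) : ℕ).Prime)).out
    have hcop : ¬ ℓ ∣ p := fun hd =>
      hℓ (((Nat.prime_dvd_prime_iff_eq Fact.out hprime).mp hd) ▸ hp)
    refine Padic.norm_rat_le_one ?_
    rwa [Rat.inv_natCast_den_of_pos hprime.pos]
  exact hle hq

/-- An element of `ℤ[1/P]` that is integral at every prime of `P` is an integer. -/
theorem ZinvP.exists_int_eq {P : Finset ℕ} [∀ p : ↥P, Fact (Nat.Prime (p : ℕ))] {q : ℚ}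
    (hq : q ∈ ZinvP P) (h : ∀ p : ↥P, ‖(q : ℚ_[(p : ℕ)])‖ ≤ 1) : ∃ n : ℤ, (n : ℚ) = q := by
  refine Rat.exists_int_eq_of_forall_padic_norm_le_one fun ℓ _ => ?_
  by_cases hℓ : ℓ ∈ P
  · exact h ⟨ℓ, hℓ⟩
  · exact ZinvP.padic_norm_le_one hq hℓ

/-- A positive unit of `ℤ[1/P]` that is a unit at every prime of `P` equals `1`. -/
theorem ZinvP.eq_one_of_mul_eq_one {P : Finset ℕ} [∀ p : ↥P, Fact (Nat.Prime (p : ℕ))] {q r : ℚ}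
    (hq : q ∈ ZinvP P) (hr : r ∈ ZinvP P) (hqr : q * r = 1) (hpos : 0 < q)
    (h : ∀ p : ↥P, ‖(q : ℚ_[(p : ℕ)])‖ = 1) : q = 1 := by
  obtain ⟨m, rfl⟩ := ZinvP.exists_int_eq hq fun p => (h p).le
  obtain ⟨n, rfl⟩ := ZinvP.exists_int_eq hr fun p => by
    have hmul := congrArg (fun x : ℚ => ‖(x : ℚ_[(p : ℕ)])‖) hqr
    simp only [Rat.cast_mul, norm_mul, h p, one_mul, Rat.cast_one, norm_one] at hmul
    exact hmul.le
  norm_cast at hqr hpos ⊢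
  rcases Int.eq_one_or_neg_one_of_mul_eq_one hqr with h1 | h1 <;> omega

theorem aDiagF_coe {K : Type*} [Field K] {y : K} (hy : y ≠ 0) :
    (aDiagF y : Matrix (Fin 2) (Fin 2) K) = !![y, 0; 0, y⁻¹] := by
  simp [aDiagF, hy]

/-- Comparing the first columns in `a_y = g a_z u_t`. -/
theorem first_column_of_aDiagF_eq {K : Type*} [Field K] {y z t : K} (hy : y ≠ 0) (hz : z ≠ 0)
    {g : Matrix.SpecialLinearGroup (Fin 2) K} (h : aDiagF y = g * aDiagF z * uF t) :
    y = g 0 0 * z ∧ g 1 0 = 0 := by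
  have hmat : !![y, 0; 0, y⁻¹] = g.1 * !![z, 0; 0, z⁻¹] * !![1, t; 0, 1] := by
    rw [← aDiagF_coe hy, ← aDiagF_coe hz, h]
    rfl
  have h00 := congrFun (congrFun hmat 0) 0
  have h10 := congrFun (congrFun hmat 1) 0
  simp [Matrix.mul_apply, Fin.sum_univ_two] at h00 h10
  exact ⟨h00, h10.resolve_right hz⟩

/-- If `y = (y_∞, (y_p))` and `z = (z_∞, (z_p))` with `y_∞, z_∞ > 0` and
`y_p, z_p ∈ ℤ_pˣ` (i.e. `‖y_p‖ = ‖z_p‖ = 1`) define the same orbit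
`Δ(SL₂(ℤ[1/P]))·a_y·U = Δ(SL₂(ℤ[1/P]))·a_z·U` in `Δ(SL₂(ℤ[1/P]))\G`, then `y = z`:
the parametrization `y ↦ 𝒰_y` of periodic horocycle orbits by
`ℝ_{>0} × ∏_{p∈P} ℤ_pˣ` is injective. -/
theorem periodic_horocycle_orbit_parametrization_injective
    (y₁ z₁ : ℝ) (hy₁ : 0 < y₁) (hz₁ : 0 < z₁)
    (y₂ z₂ : (p : ↥P) → ℚ_[(p : ℕ)])
    (hy₂ : ∀ p : ↥P, ‖y₂ p‖ = 1) (hz₂ : ∀ p : ↥P, ‖z₂ p‖ = 1)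
    (horb : {x : GP P | ∃ γ ∈ ΓP P, ∃ t : QP P, x = γ * aY P y₁ y₂ * uT P t} =
      {x : GP P | ∃ γ ∈ ΓP P, ∃ t : QP P, x = γ * aY P z₁ z₂ * uT P t}) :
    y₁ = z₁ ∧ y₂ = z₂ := by
  have hmem : aY P y₁ y₂ ∈ {x : GP P | ∃ γ ∈ ΓP P, ∃ t : QP P, x = γ * aY P z₁ z₂ * uT P t} := by
    rw [← horb]
    refine ⟨1, one_mem _, 0, ?_⟩
    have hu : uT P 0 = 1 := by
      refine Prod.ext ?_ (funext fun p => ?_) <;> ext i j <;> fin_cases i <;> fin_cases j <;>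
        simp [uT, uF]
    rw [hu, one_mul, mul_one]
  obtain ⟨_, ⟨g, rfl⟩, t, hγ⟩ := hmem
  have hy₂' : ∀ p, y₂ p ≠ 0 := fun p => norm_ne_zero_iff.mp (by simp [hy₂ p])
  have hz₂' : ∀ p, z₂ p ≠ 0 := fun p => norm_ne_zero_iff.mp (by simp [hz₂ p])
  obtain ⟨hreal, hlower⟩ := first_column_of_aDiagF_eq hy₁.ne' hz₁.ne' (congrArg Prod.fst hγ)
  have hpadic : ∀ p, y₂ p = ((g 0 0 : ℚ) : ℚ_[(p : ℕ)]) * z₂ p := fun p =>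
    (first_column_of_aDiagF_eq (hy₂' p) (hz₂' p) (congrFun (congrArg Prod.snd hγ) p)).1
  replace hreal : y₁ = ((g 0 0 : ℚ) : ℝ) * z₁ := hreal
  replace hlower : ((g 1 0 : ℚ) : ℝ) = 0 := hlower
  have hg10 : g 1 0 = 0 := Subtype.ext (Rat.cast_eq_zero.mp hlower)
  have hdet : g 0 0 * g 1 1 = 1 := by
    have hd := g.det_coe
    rwa [Matrix.det_fin_two, hg10, mul_zero, sub_zero] at hd
  have hpos : (0 : ℚ) < g 0 0 := by
    have : (0 : ℝ) < ((g 0 0 : ℚ) : ℝ) := pos_of_mul_pos_left (hreal ▸ hy₁) hz₁.le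
    exact_mod_cast this
  have hone : (g 0 0 : ℚ) = 1 :=
    ZinvP.eq_one_of_mul_eq_one (g 0 0).2 (g 1 1).2 (congrArg Subtype.val hdet) hpos fun p => by
      have hnorm := congrArg norm (hpadic p)
      rwa [norm_mul, hy₂ p, hz₂ p, mul_one, eq_comm] at hnorm
  exact ⟨by simpa [hone] using hreal, funext fun p => by simpa [hone] using hpadic p⟩
end
end

section
/- Let P be a finite set of primes and g ∈ SL₂(ℝ). Then sup{ ‖g⁻¹ w g‖_∞^{−1} : w ∈ M₂(ℤ), tr w = 0, w ≠ 0 } = sup{ ( ‖g⁻¹ v g‖_∞ · ∏_{p∈P} ‖v‖_p )^{−1} : v ∈ M₂(ℤ[1/P]), tr v = 0, v ≠ 0 }, where both suprema are taken in [0, ∞]. (This identifies the S-arithmetic height of a real point with its height in the real quotient.) -/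
/-!
The `S`-arithmetic height of a real point coincides with its height in the real
quotient.
-/

set_option linter.unusedSectionVars false

noncomputable section
open MeasureTheory Matrix
open scoped ENNReal

variable (P : Finset ℕ) [∀ p : ↥P, Fact (Nat.Prime (p : ℕ))]

/-- Maximum of the absolute values of the entries of a real `2×2` matrix. -/
def matSup (A : Matrix (Fin 2) (Fin 2) ℝ) : ℝ :=
  max (max |A 0 0| |A 0 1|) (max |A 1 0| |A 1 1|)

/-- `‖v‖_p`: the maximum of the `p`-adic absolute values of the entries of a rational
`2×2` matrix. -/
def pMatNorm (p : ↥P) (v : Matrix (Fin 2) (Fin 2) ℚ) : ℝ :=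
  max (max ‖((v 0 0 : ℚ) : ℚ_[(p : ℕ)])‖ ‖((v 0 1 : ℚ) : ℚ_[(p : ℕ)])‖)
    (max ‖((v 1 0 : ℚ) : ℚ_[(p : ℕ)])‖ ‖((v 1 1 : ℚ) : ℚ_[(p : ℕ)])‖)

lemma norm_le_one_of_mem_ZinvP {q : ℕ} [Fact q.Prime] (hq : q ∉ P)
    {x : ℚ} (hx : x ∈ ZinvP P) : ‖(x : ℚ_[q])‖ ≤ 1 := by
  suffices ZinvP P ≤ (PadicInt.subring q).comap (Rat.castHom ℚ_[q]) from this hx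
  refine Subring.closure_le.2 ?_
  rintro _ ⟨p, hp, rfl⟩
  have hp' : p.Prime := (inferInstance : Fact (Nat.Prime ((⟨p, hp⟩ : ↥P) : ℕ))).out
  have h : ‖(p : ℚ_[q])‖ = 1 := Padic.norm_natCast_eq_one_iff.2
    ((Nat.coprime_primes Fact.out hp').2 fun h => hq (h ▸ hp))
  change ‖(((p : ℚ)⁻¹ : ℚ) : ℚ_[q])‖ ≤ 1
  simp [h]

lemma Rat.exists_intCast_eq_of_padic_norm_le_one {x : ℚ}
    (h : ∀ (q : ℕ) [Fact q.Prime], ‖(x : ℚ_[q])‖ ≤ 1) : ∃ n : ℤ, (n : ℚ) = x := by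
  refine ⟨x.num, (Rat.den_eq_one_iff x).1 ?_⟩
  by_contra hx
  obtain ⟨q, hq, hqx⟩ := Nat.exists_prime_and_dvd hx
  have : Fact q.Prime := ⟨hq⟩
  exact Rat.padicValuation_le_one_iff.1
    ((Padic.norm_rat_le_one_iff_padicValuation_le_one q).1 (h q)) hqx

lemma norm_le_pMatNorm (p : ↥P) (v : Matrix (Fin 2) (Fin 2) ℚ) (i j : Fin 2) :
    ‖((v i j : ℚ) : ℚ_[(p : ℕ)])‖ ≤ pMatNorm P p v := by
  fin_cases i <;> fin_cases j <;> simp [pMatNorm]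

lemma exists_pMatNorm_eq (p : ↥P) (v : Matrix (Fin 2) (Fin 2) ℚ) :
    ∃ i j, pMatNorm P p v = ‖((v i j : ℚ) : ℚ_[(p : ℕ)])‖ := by
  unfold pMatNorm
  simp only [Fin.exists_fin_two]
  grind

lemma pMatNorm_nonneg (p : ↥P) (v : Matrix (Fin 2) (Fin 2) ℚ) : 0 ≤ pMatNorm P p v :=
  (norm_nonneg _).trans (norm_le_pMatNorm P p v 0 0)

lemma exists_pMatNorm_eq_zpow (p : ↥P) {v : Matrix (Fin 2) (Fin 2) ℚ} (hv : v ≠ 0) :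
    ∃ n : ℤ, pMatNorm P p v = (p : ℝ) ^ n := by
  obtain ⟨i, j, hij⟩ := exists_pMatNorm_eq P p v
  rw [hij]
  refine ⟨_, Padic.norm_eq_zpow_neg_valuation fun h => hv ?_⟩
  ext k l
  have hkl := norm_le_pMatNorm P p v k l
  rw [hij, h, norm_zero] at hkl
  simpa only [norm_le_zero_iff, Rat.cast_eq_zero, Matrix.zero_apply] using hkl

lemma pMatNorm_intCast_le_one (p : ↥P) (w : Matrix (Fin 2) (Fin 2) ℤ) :
    pMatNorm P p (w.map (Int.cast : ℤ → ℚ)) ≤ 1 := by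
  obtain ⟨i, j, hij⟩ := exists_pMatNorm_eq P p (w.map (Int.cast : ℤ → ℚ))
  rw [hij]
  simpa using Padic.norm_int_le_one (p := p) (w i j)

lemma norm_prod_zpow_of_mem (n : ↥P → ℤ) (q : ↥P) :
    ‖((∏ p : ↥P, ((p : ℕ) : ℚ) ^ n p : ℚ) : ℚ_[(q : ℕ)])‖ = (((q : ℕ) : ℝ) ^ n q)⁻¹ := by
  push_cast
  rw [norm_prod, Finset.prod_eq_single q (fun p _ hpq => ?_) (by simp), Padic.norm_p_zpow,
    _root_.zpow_neg]
  have h : ‖((p : ℕ) : ℚ_[(q : ℕ)])‖ = 1 := Padic.norm_natCast_eq_one_iff.2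
    ((Nat.coprime_primes Fact.out Fact.out).2 fun h => hpq (Subtype.ext h.symm))
  rw [norm_zpow, h, _root_.one_zpow]

lemma norm_prod_zpow_of_notMem (n : ↥P → ℤ) {q : ℕ} [Fact q.Prime] (hq : q ∉ P) :
    ‖((∏ p : ↥P, ((p : ℕ) : ℚ) ^ n p : ℚ) : ℚ_[q])‖ = 1 := by
  push_cast
  rw [norm_prod]
  refine Finset.prod_eq_one fun p _ => ?_
  have h : ‖((p : ℕ) : ℚ_[q])‖ = 1 := Padic.norm_natCast_eq_one_iff.2
    ((Nat.coprime_primes Fact.out Fact.out).2 fun h => hq (h ▸ p.2))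
  rw [norm_zpow, h, _root_.one_zpow]

/-- Multiplying a nonzero matrix over `ℤ[1/P]` by `∏_{p ∈ P} ‖v‖_p` makes it integral. -/
lemma exists_int_matrix_eq_smul {v : Matrix (Fin 2) (Fin 2) ℚ}
    (hv : ∀ i j, v i j ∈ ZinvP P) (hv0 : v ≠ 0) :
    ∃ (c : ℚ) (w : Matrix (Fin 2) (Fin 2) ℤ), 0 < c ∧ (c : ℝ) = ∏ p : ↥P, pMatNorm P p v ∧
      w.map (Int.cast : ℤ → ℚ) = c • v := by
  choose n hn using fun p : ↥P => exists_pMatNorm_eq_zpow P p hv0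
  have hpos (p : ↥P) : 0 < (p : ℕ) := (Fact.out : (p : ℕ).Prime).pos
  set c : ℚ := ∏ p : ↥P, ((p : ℕ) : ℚ) ^ n p with hc
  have key (i j : Fin 2) : ∃ z : ℤ, (z : ℚ) = c * v i j := by
    refine Rat.exists_intCast_eq_of_padic_norm_le_one fun q _ => ?_
    rw [Rat.cast_mul, norm_mul]
    by_cases hq : q ∈ P
    · have h := norm_le_pMatNorm P ⟨q, hq⟩ v i j
      rw [hn] at h
      have hq0 : (0 : ℝ) < (q : ℝ) ^ n ⟨q, hq⟩ := zpow_pos (mod_cast hpos ⟨q, hq⟩) _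
      rw [hc, norm_prod_zpow_of_mem P n ⟨q, hq⟩, inv_mul_le_one₀ hq0]
      exact h
    · rw [hc, norm_prod_zpow_of_notMem P n hq, one_mul]
      exact norm_le_one_of_mem_ZinvP P hq (hv i j)
  choose w hw using key
  refine ⟨c, Matrix.of w, Finset.prod_pos fun p _ => zpow_pos (mod_cast hpos p) _, ?_, ?_⟩
  · simp [hc, hn]
  · ext i j
    simp [hw]

lemma matSup_nonneg (A : Matrix (Fin 2) (Fin 2) ℝ) : 0 ≤ matSup A :=
  (abs_nonneg _).trans ((le_max_left _ _).trans (le_max_left _ _))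

lemma matSup_smul {c : ℝ} (hc : 0 ≤ c) (A : Matrix (Fin 2) (Fin 2) ℝ) :
    matSup (c • A) = c * matSup A := by
  simp [matSup, abs_mul, abs_of_nonneg hc, mul_max_of_nonneg _ _ hc]

/-- For `g ∈ SL₂(ℝ)`,
`sup{‖g⁻¹wg‖_∞⁻¹ : w ∈ M₂(ℤ), tr w = 0, w ≠ 0}
  = sup{(‖g⁻¹vg‖_∞ · ∏_{p∈P} ‖v‖_p)⁻¹ : v ∈ M₂(ℤ[1/P]), tr v = 0, v ≠ 0}`,
both suprema taken in `[0, ∞]`. -/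
theorem sarithmetic_height_eq_real_height (g : Matrix.SpecialLinearGroup (Fin 2) ℝ) :
    sSup {r : ℝ≥0∞ | ∃ w : Matrix (Fin 2) (Fin 2) ℤ, w ≠ 0 ∧ w.trace = 0 ∧
        r = (ENNReal.ofReal (matSup
          (((g⁻¹ : Matrix.SpecialLinearGroup (Fin 2) ℝ) : Matrix (Fin 2) (Fin 2) ℝ) *
            w.map (Int.cast : ℤ → ℝ) * (g : Matrix (Fin 2) (Fin 2) ℝ))))⁻¹} =
      sSup {r : ℝ≥0∞ | ∃ v : Matrix (Fin 2) (Fin 2) ℚ,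
        (∀ i j : Fin 2, v i j ∈ ZinvP P) ∧ v ≠ 0 ∧ v.trace = 0 ∧
        r = (ENNReal.ofReal (matSup
            (((g⁻¹ : Matrix.SpecialLinearGroup (Fin 2) ℝ) : Matrix (Fin 2) (Fin 2) ℝ) *
              v.map (Rat.cast : ℚ → ℝ) * (g : Matrix (Fin 2) (Fin 2) ℝ)) *
          ∏ p : ↥P, pMatNorm P p v))⁻¹} := by
  refine le_antisymm (sSup_le ?_) (sSup_le ?_)
  · rintro _ ⟨w, hw0, hw, rfl⟩
    refine le_trans ?_ (le_sSup ⟨w.map (Int.cast : ℤ → ℚ), fun i j => ?_, fun h => hw0 ?_, ?_, rfl⟩)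
    · rw [Matrix.map_map]
      have hcomp : (Rat.cast : ℚ → ℝ) ∘ (Int.cast : ℤ → ℚ) = Int.cast := by
        ext
        simp
      rw [hcomp]
      refine ENNReal.inv_le_inv.2 (ENNReal.ofReal_le_ofReal ?_)
      exact mul_le_of_le_one_right (matSup_nonneg _) (Finset.prod_le_one
        (fun p _ => pMatNorm_nonneg P p _) fun p _ => pMatNorm_intCast_le_one P p w)
    · exact intCast_mem (ZinvP P) (w i j)
    · ext i j
      simpa using congr_fun₂ h i j
    · rw [Matrix.trace_fin_two] at hw ⊢
      simp only [Matrix.map_apply]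
      exact_mod_cast hw
  · rintro _ ⟨v, hv, hv0, hvt, rfl⟩
    obtain ⟨c, w, hc, hcv, hw⟩ := exists_int_matrix_eq_smul P hv hv0
    refine le_sSup ⟨w, fun h => ?_, ?_, ?_⟩
    · rw [h, Matrix.map_zero _ Int.cast_zero] at hw
      exact (smul_ne_zero hc.ne' hv0) hw.symm
    · have h := congr_arg Matrix.trace hw
      rw [Matrix.trace_smul, hvt, smul_zero, Matrix.trace_fin_two, Matrix.map_apply,
        Matrix.map_apply] at h
      rw [Matrix.trace_fin_two]
      exact_mod_cast h
    · have hwR : w.map (Int.cast : ℤ → ℝ) = (c : ℝ) • v.map (Rat.cast : ℚ → ℝ) := by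
        ext i j
        have h := congr_fun₂ hw i j
        simp only [Matrix.map_apply, Matrix.smul_apply, smul_eq_mul] at h ⊢
        exact_mod_cast congr_arg (Rat.cast : ℚ → ℝ) h
      rw [hwR, ← hcv, Matrix.mul_smul, Matrix.smul_mul, matSup_smul (by exact_mod_cast hc.le),
        mul_comm]

end
end

section
/- Let P be a finite set of primes, 𝕋_P = ℚ_P / Δ(ℤ[1/P]) the quotient topological group, and m a translation-invariant Borel probability measure on 𝕋_P. Then for every smooth function φ : 𝕋_P → ℂ there exists a constant C_φ > 0 such that for every n ∈ ℕ+ with gcd(n, p) = 1 for all p ∈ P, | n⁻¹ · Σ_{k=0}^{n−1} φ( Δ(k/n) + Δ(ℤ[1/P]) ) − ∫_{𝕋_P} φ dm | ≤ C_φ / n. In particular the rational points { Δ(k/n) + Δ(ℤ[1/P]) : 0 ≤ k < n } equidistribute in 𝕋_P with rate 1/n as n → ∞ along n coprime to all primes of P. -/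
/-!
Effective equidistribution, with rate `1/n`, of the rational points of denominator `n` on
the `S`-arithmetic solenoid `𝕋_P = ℚ_P/Δ(ℤ[1/P])`, along `n` coprime to the primes in
`P`.
-/

set_option linter.unusedSectionVars false

noncomputable section
open MeasureTheory Matrix

variable (P : Finset ℕ) [∀ p : ↥P, Fact (Nat.Prime (p : ℕ))]

/-- The real direction `ℝ → 𝕋_P`, `s ↦ (s, 0) mod Δ(ℤ[1/P])`. -/
def iotaR (s : ℝ) : TP P := QuotientAddGroup.mk ((s, 0) : QP P)

/-- A function `φ : 𝕋_P → ℂ` is smooth if it is invariant under the image in `𝕋_P` of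
`{0} × ∏_{p∈P} p^{m(p)}ℤ_p` for some `m : P → ℕ`, and if it is infinitely differentiable
in the real direction with all derivatives continuous on `𝕋_P`. -/
def IsSmoothTP (φ : TP P → ℂ) : Prop :=
  (∃ m : ↥P → ℕ, ∀ (t : TP P) (u : (p : ↥P) → ℚ_[(p : ℕ)]),
      (∀ p : ↥P, ‖u p‖ ≤ ((p : ℕ) : ℝ) ^ (-(m p : ℤ))) →
      φ (t + QuotientAddGroup.mk (((0 : ℝ), u) : QP P)) = φ t) ∧
    (∀ t : TP P, ContDiff ℝ (⊤ : ℕ∞) fun s : ℝ => φ (t + iotaR P s)) ∧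
    (∀ j : ℕ, Continuous fun t : TP P =>
      iteratedDeriv j (fun s : ℝ => φ (t + iotaR P s)) 0)

theorem sum_range_add_eq_of_periodic {M : Type*} [AddCommGroup M] {h : ℤ → M} {n : ℕ}
    (hh : Function.Periodic h n) (j : ℤ) :
    ∑ k ∈ Finset.range n, h (j + k) = ∑ k ∈ Finset.range n, h k := by
  have step (i : ℤ) :
      ∑ k ∈ Finset.range n, h (i + 1 + k) = ∑ k ∈ Finset.range n, h (i + k) := by
    have h1 := Finset.sum_range_succ (fun k : ℕ => h (i + k)) n
    have h2 := Finset.sum_range_succ' (fun k : ℕ => h (i + k)) n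
    rw [h1, hh i] at h2
    simp only [Nat.cast_zero, add_zero] at h2
    rw [add_right_cancel h2]
    refine Finset.sum_congr rfl fun k _ => ?_
    push_cast
    ring_nf
  induction j using Int.induction_on with
  | zero => simp
  | succ i ih => rw [step, ih]
  | pred i ih => rw [← ih, ← step (-(i : ℤ) - 1), sub_add_cancel]

/-- A periodic `C¹` function on the line is bounded and Lipschitz. -/
theorem exists_bound_and_lipschitz_of_periodic {E : Type*} [NormedAddCommGroup E]
    [NormedSpace ℝ E] {f : ℝ → E} {c : ℝ} (hf : ContDiff ℝ 1 f) (hc : c ≠ 0)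
    (hp : Function.Periodic f c) :
    ∃ B : ℝ, 0 ≤ B ∧ (∀ x, ‖f x‖ ≤ B) ∧ ∀ x y, ‖f x - f y‖ ≤ B * |x - y| := by
  have hpd : Function.Periodic (deriv f) c := fun x => by
    rw [← deriv_comp_add_const, show (fun x => f (x + c)) = f from funext hp]
  obtain ⟨B₁, hB₁⟩ := (hp.isBounded_of_continuous hc hf.continuous).exists_norm_le
  obtain ⟨B₂, hB₂⟩ :=
    (hpd.isBounded_of_continuous hc (hf.continuous_deriv le_rfl)).exists_norm_le
  have h₁ (x : ℝ) : ‖f x‖ ≤ B₁ := hB₁ _ ⟨x, rfl⟩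
  have h₂ (x : ℝ) : ‖deriv f x‖ ≤ B₂ := hB₂ _ ⟨x, rfl⟩
  refine ⟨max B₁ B₂, (norm_nonneg _).trans ((h₁ 0).trans (le_max_left _ _)),
    fun x => (h₁ x).trans (le_max_left _ _), fun x y => ?_⟩
  exact convex_univ.norm_image_sub_le_of_norm_deriv_le
    (fun z _ => (hf.differentiable one_ne_zero) z)
    (fun z _ => (h₂ z).trans (le_max_right _ _)) (Set.mem_univ y) (Set.mem_univ x)

theorem Padic.norm_natCast_le_of_pow_dvd {p : ℕ} [Fact p.Prime] {a k : ℕ} (h : p ^ k ∣ a) :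
    ‖(a : ℚ_[p])‖ ≤ (p : ℝ) ^ (-(k : ℤ)) := by
  have := (Padic.norm_int_le_pow_iff_dvd (p := p) (a : ℤ) k).2 (by exact_mod_cast h)
  simpa using this

theorem Padic.exists_nat_norm_sub_le {p : ℕ} [Fact p.Prime] {x : ℚ_[p]} (hx : ‖x‖ ≤ 1)
    (k : ℕ) : ∃ c : ℕ, ‖x - c‖ ≤ (p : ℝ) ^ (-(k : ℤ)) := by
  obtain ⟨x, rfl⟩ : ∃ y : ℤ_[p], (y : ℚ_[p]) = x := ⟨⟨x, hx⟩, rfl⟩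
  refine ⟨PadicInt.appr x k, ?_⟩
  have := (PadicInt.norm_le_pow_iff_mem_span_pow _ k).2 (PadicInt.appr_spec k x)
  rwa [PadicInt.norm_def, PadicInt.coe_sub, PadicInt.coe_natCast] at this

/-- Simultaneous approximation of `p`-adic integers by a natural number. -/
theorem exists_nat_forall_norm_sub_le (x : (p : ↥P) → ℚ_[(p : ℕ)]) (hx : ∀ p, ‖x p‖ ≤ 1)
    (e : ↥P → ℕ) : ∃ b : ℕ, ∀ p : ↥P, ‖x p - b‖ ≤ ((p : ℕ) : ℝ) ^ (-(e p : ℤ)) := by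
  choose c hc using fun p : ↥P => Padic.exists_nat_norm_sub_le (hx p) (e p)
  have hprime (p : ↥P) : (p : ℕ).Prime := Fact.out
  obtain ⟨b, hb⟩ := Nat.chineseRemainderOfFinset c (fun p : ↥P => (p : ℕ) ^ e p) Finset.univ
    (fun p _ => pow_ne_zero _ (hprime p).ne_zero)
    (fun p _ q _ hpq => Nat.Coprime.pow _ _
      ((Nat.coprime_primes (hprime p) (hprime q)).2 fun h => hpq (Subtype.ext h)))
  refine ⟨b, fun p => ?_⟩
  have h1 : ‖((c p - b : ℤ) : ℚ_[(p : ℕ)])‖ ≤ ((p : ℕ) : ℝ) ^ (-(e p : ℤ)) :=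
    (Padic.norm_int_le_pow_iff_dvd _ _).2
      (by exact_mod_cast (Nat.modEq_iff_dvd.1 (hb p (Finset.mem_univ p))))
  have h2 : x p - b = (x p - c p) + ((c p - b : ℤ) : ℚ_[(p : ℕ)]) := by push_cast; ring
  rw [h2]
  exact (Padic.nonarchimedean _ _).trans (max_le (hc p) h1)

/-- Strong approximation: `ℤ[1/P]` is dense in `∏_{p ∈ P} ℚ_p`. -/
theorem exists_mem_ZinvP_forall_norm_sub_le (u : (p : ↥P) → ℚ_[(p : ℕ)]) (m : ↥P → ℕ) :
    ∃ a ∈ ZinvP P, ∀ p : ↥P, ‖u p - (a : ℚ)‖ ≤ ((p : ℕ) : ℝ) ^ (-(m p : ℤ)) := by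
  have hprime (p : ↥P) : (p : ℕ).Prime := Fact.out
  have hone (p : ↥P) : (1 : ℝ) < (p : ℕ) := by exact_mod_cast (hprime p).one_lt
  choose k hk using fun p : ↥P => pow_unbounded_of_one_lt ‖u p‖ (hone p)
  set D : ℕ := ∏ q : ↥P, (q : ℕ) ^ k q with hD
  have hD0 : D ≠ 0 := Finset.prod_ne_zero_iff.2 fun q _ => pow_ne_zero _ (hprime q).ne_zero
  have hDp (p : ↥P) : 0 < ‖(D : ℚ_[(p : ℕ)])‖ := norm_pos_iff.2 (Nat.cast_ne_zero.2 hD0)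
  have hDinv : ((D : ℚ))⁻¹ ∈ ZinvP P := by
    rw [hD]
    push_cast
    rw [← Finset.prod_inv_distrib]
    refine Subring.prod_mem _ fun q _ => ?_
    rw [← inv_pow]
    have hq : ((q : ℕ) : ℚ)⁻¹ ∈ ZinvP P := Subring.subset_closure ⟨(q : ℕ), q.2, rfl⟩
    exact Subring.pow_mem _ hq _
  have hint (p : ↥P) : ‖(D : ℚ_[(p : ℕ)]) * u p‖ ≤ 1 := by
    have h1 : ‖(D : ℚ_[(p : ℕ)])‖ ≤ ((p : ℕ) : ℝ) ^ (-(k p : ℤ)) :=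
      Padic.norm_natCast_le_of_pow_dvd
        (Finset.dvd_prod_of_mem (fun q : ↥P => (q : ℕ) ^ k q) (Finset.mem_univ p))
    have h0 : (0 : ℝ) < ((p : ℕ) : ℝ) ^ k p := pow_pos (zero_lt_one.trans (hone p)) _
    rw [norm_mul]
    calc _ ≤ ((p : ℕ) : ℝ) ^ (-(k p : ℤ)) * ((p : ℕ) : ℝ) ^ k p :=
          mul_le_mul h1 (hk p).le (norm_nonneg _) (by positivity)
      _ = 1 := by rw [_root_.zpow_neg, zpow_natCast, inv_mul_cancel₀ h0.ne']
  choose E hE using fun p : ↥P =>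
    exists_pow_lt_of_lt_one (hDp p) (inv_lt_one_of_one_lt₀ (hone p))
  obtain ⟨b, hb⟩ := exists_nat_forall_norm_sub_le P (fun p => D * u p) hint
    (fun p => m p + E p)
  refine ⟨b * (D : ℚ)⁻¹, Subring.mul_mem _ (natCast_mem _ b) hDinv, fun p => ?_⟩
  have hD' : (D : ℚ_[(p : ℕ)]) ≠ 0 := Nat.cast_ne_zero.2 hD0
  have h3 : (D : ℚ_[(p : ℕ)]) * (u p - ((b * (D : ℚ)⁻¹ : ℚ) : ℚ_[(p : ℕ)])) = D * u p - b := by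
    push_cast
    field_simp
  refine le_of_mul_le_mul_left ?_ (hDp p)
  rw [← norm_mul, h3]
  refine (hb p).trans ?_
  have h0 : (0 : ℝ) < (p : ℕ) := zero_lt_one.trans (hone p)
  rw [Nat.cast_add, neg_add, zpow_add₀ h0.ne', mul_comm]
  refine mul_le_mul_of_nonneg_right ?_ (by positivity)
  rw [_root_.zpow_neg, zpow_natCast, ← inv_pow]
  exact (hE p).le

theorem mk_ratDiag_eq_zero {a : ℚ} (ha : a ∈ ZinvP P) :
    (QuotientAddGroup.mk (ratDiag P a) : TP P) = 0 :=
  (QuotientAddGroup.eq_zero_iff _).2 ⟨⟨a, ha⟩, rfl⟩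

theorem iotaR_add (x y : ℝ) : iotaR P (x + y) = iotaR P x + iotaR P y := by
  rw [iotaR, iotaR, iotaR, ← QuotientAddGroup.mk_add, Prod.mk_add_mk, add_zero]

/-- `φ` has level `m`: it is invariant under `{0} × ∏_{p ∈ P} p^{m(p)}ℤ_p`. -/
def HasLevelTP (m : ↥P → ℕ) (φ : TP P → ℂ) : Prop :=
  ∀ (t : TP P) (u : (p : ↥P) → ℚ_[(p : ℕ)]),
    (∀ p : ↥P, ‖u p‖ ≤ ((p : ℕ) : ℝ) ^ (-(m p : ℤ))) →
      φ (t + QuotientAddGroup.mk (((0 : ℝ), u) : QP P)) = φ t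

section Level

variable {P} {φ : TP P → ℂ} {m : ↥P → ℕ}

/-- A function of level `m` does not distinguish `Δ(q)` from `(q, 0)` when `q` is divisible by
`p ^ m p` in `ℤ_p` for all `p ∈ P`. -/
theorem apply_add_mk_ratDiag_of_norm_le (hinv : HasLevelTP P m φ) {q : ℚ}
    (hq : ∀ p : ↥P, ‖(q : ℚ_[(p : ℕ)])‖ ≤ ((p : ℕ) : ℝ) ^ (-(m p : ℤ))) (v : TP P) :
    φ (v + QuotientAddGroup.mk (ratDiag P q)) = φ (v + iotaR P q) := by
  rw [← hinv (v + iotaR P q) (fun p => (q : ℚ_[(p : ℕ)])) hq, add_assoc, iotaR,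
    ← QuotientAddGroup.mk_add, Prod.mk_add_mk, add_zero, zero_add]
  rfl

/-- Modulo its invariance, the argument of a function of level `m` may be taken on the real
line. -/
theorem exists_forall_apply_add_eq (hinv : HasLevelTP P m φ) (t : TP P) :
    ∃ y : ℝ, ∀ v : TP P, φ (v + t) = φ (v + iotaR P y) := by
  obtain ⟨⟨x, u⟩, rfl⟩ := QuotientAddGroup.mk_surjective t
  obtain ⟨a, ha, hau⟩ := exists_mem_ZinvP_forall_norm_sub_le P u m
  refine ⟨x - a, fun v => ?_⟩
  rw [← hinv (v + iotaR P (x - a)) (fun p => u p - (a : ℚ_[(p : ℕ)])) hau, add_assoc, iotaR,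
    ← QuotientAddGroup.mk_add, Prod.mk_add_mk, add_zero, zero_add]
  congr 2
  rw [← sub_eq_zero, ← QuotientAddGroup.mk_sub, ← mk_ratDiag_eq_zero P ha]
  congr 1
  ext
  · simp [ratDiag]
  · simp [ratDiag]
    rfl

theorem periodic_apply_iotaR (hinv : HasLevelTP P m φ) {N : ℕ}
    (hN : ∀ p : ↥P, (p : ℕ) ^ m p ∣ N) :
    Function.Periodic (fun s : ℝ => φ (iotaR P s)) N := fun s => by
  have h := apply_add_mk_ratDiag_of_norm_le hinv (q := N)
    (fun p => by simpa using Padic.norm_natCast_le_of_pow_dvd (hN p)) (iotaR P s)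
  rw [mk_ratDiag_eq_zero P (natCast_mem _ N), add_zero, ← iotaR_add] at h
  simpa using h.symm

/-- Translating by `t` changes the sum of a function of level `m` over the points `Δ(k/n)` by a
bounded amount, since up to invariance `t` is within `N/n` of some `Δ(Nj/n)`. -/
theorem norm_sum_sub_sum_translate_le (hinv : HasLevelTP P m φ) {N : ℕ}
    (hN : ∀ p : ↥P, (p : ℕ) ^ m p ∣ N) (hN0 : 0 < N)
    {B : ℝ} (hB : 0 ≤ B)
    (hlip : ∀ x y, ‖φ (iotaR P x) - φ (iotaR P y)‖ ≤ B * |x - y|)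
    {n : ℕ} (hn : 0 < n) (hcop : ∀ p ∈ P, Nat.gcd n p = 1) (t : TP P) :
    ‖∑ k ∈ Finset.range n, φ (QuotientAddGroup.mk (ratDiag P ((k : ℚ) / (n : ℚ)))) -
      ∑ k ∈ Finset.range n, φ (QuotientAddGroup.mk (ratDiag P ((k : ℚ) / (n : ℚ))) + t)‖
      ≤ B * N := by
  have hnq : (n : ℚ) ≠ 0 := Nat.cast_ne_zero.2 hn.ne'
  have hnr : (0 : ℝ) < n := Nat.cast_pos.2 hn
  have hNr : (0 : ℝ) < N := Nat.cast_pos.2 hN0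
  obtain ⟨y, hy⟩ := exists_forall_apply_add_eq hinv t
  set h : ℤ → ℂ := fun k => φ (QuotientAddGroup.mk (ratDiag P ((k : ℚ) / (n : ℚ)))) with hh
  have hper : Function.Periodic h n := fun k => by
    have h1 : (((k + n : ℤ) : ℚ) / n) = (k : ℚ) / n + 1 := by
      push_cast
      field_simp
    simp only [hh]
    rw [h1, map_add, QuotientAddGroup.mk_add, mk_ratDiag_eq_zero P (one_mem _), add_zero]
  set j : ℤ := ⌊y * n / N⌋ with hj
  have hclose : |(N * j / n : ℝ) - y| ≤ N / n := by
    have h1 := Int.floor_le (y * n / N)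
    have h2 := (Int.lt_floor_add_one (y * n / N)).le
    rw [← hj, le_div_iff₀ hNr] at h1
    rw [← hj, div_le_iff₀ hNr] at h2
    rw [abs_sub_le_iff]
    constructor
    · rw [sub_le_iff_le_add, div_le_iff₀ hnr, add_mul, div_mul_cancel₀ _ hnr.ne']
      linarith
    · rw [sub_le_iff_le_add, ← add_div, le_div_iff₀ hnr]
      linarith
  have hsmall (p : ↥P) : ‖(((N * j / n : ℚ)) : ℚ_[(p : ℕ)])‖ ≤ ((p : ℕ) : ℝ) ^ (-(m p : ℤ)) := by
    have h1 : ‖(n : ℚ_[(p : ℕ)])‖ = 1 :=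
      Padic.norm_natCast_eq_one_iff.2 (Nat.Coprime.symm (hcop p p.2))
    push_cast
    rw [norm_div, norm_mul, h1, div_one]
    exact (mul_le_of_le_one_right (norm_nonneg _) (Padic.norm_int_le_one j)).trans
      (Padic.norm_natCast_le_of_pow_dvd (hN p))
  have hshift := sum_range_add_eq_of_periodic hper (N * j)
  have hsum : ∑ k ∈ Finset.range n, φ (QuotientAddGroup.mk (ratDiag P ((k : ℚ) / (n : ℚ)))) =
      ∑ k ∈ Finset.range n, h (N * j + k) := by
    rw [hshift]
    simp [hh]
  rw [hsum, ← Finset.sum_sub_distrib]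
  have hterm (k : ℕ) : ‖h (N * j + k) -
      φ (QuotientAddGroup.mk (ratDiag P ((k : ℚ) / (n : ℚ))) + t)‖ ≤ B * (N / n) := by
    obtain ⟨z, hz⟩ := exists_forall_apply_add_eq hinv
      (QuotientAddGroup.mk (ratDiag P ((k : ℚ) / (n : ℚ))))
    have h1 : (((N * j + k : ℤ) : ℚ) / n) = (k : ℚ) / n + N * j / n := by
      push_cast
      ring
    have h2 : h (N * j + k) = φ (iotaR P ((N * j / n : ℝ) + z)) := by
      simp only [hh]
      rw [h1, map_add, QuotientAddGroup.mk_add, apply_add_mk_ratDiag_of_norm_le hinv hsmall,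
        add_comm, hz, ← iotaR_add]
      push_cast
      rfl
    rw [h2, hy, add_comm (QuotientAddGroup.mk _), hz, ← iotaR_add]
    refine (hlip _ _).trans (mul_le_mul_of_nonneg_left ?_ hB)
    rwa [add_sub_add_right_eq_sub]
  calc _ ≤ ∑ k ∈ Finset.range n, B * ((N : ℝ) / n) :=
        norm_sum_le_of_le _ fun k _ => hterm k
    _ = B * N := by
        rw [Finset.sum_const, Finset.card_range, nsmul_eq_mul]
        field_simp

end Level

theorem measurable_of_continuous_TP {φ : TP P → ℂ} (hφ : Continuous φ) : Measurable φ := by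
  rw [QuotientAddGroup.measurable_from_quotient]
  exact (hφ.comp continuous_quotient_mk').measurable

/-- An average of translates of `φ` has the same integral as `φ`. -/
theorem integral_eq_integral_average {G : Type*} [AddCommGroup G] [MeasurableSpace G]
    {μ : Measure G} [IsProbabilityMeasure μ] (hμ : ∀ t : G, Measure.map (fun s => t + s) μ = μ)
    {φ : G → ℂ} (hφ : Integrable φ μ) {n : ℕ} (hn : 0 < n) (x : ℕ → G) :
    Integrable (fun t => ∑ k ∈ Finset.range n, φ (x k + t)) μ ∧
      ∫ t, φ t ∂μ = (n : ℂ)⁻¹ * ∫ t, ∑ k ∈ Finset.range n, φ (x k + t) ∂μ := by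
  have hmeas (g : G) : AEMeasurable (fun s => g + s) μ :=
    AEMeasurable.of_map_ne_zero (by rw [hμ]; exact IsProbabilityMeasure.ne_zero μ)
  have hint (g : G) : Integrable (fun s => φ (g + s)) μ :=
    Integrable.comp_aemeasurable (f := fun s => g + s) (by rwa [hμ]) (hmeas g)
  have heq (g : G) : ∫ s, φ (g + s) ∂μ = ∫ s, φ s ∂μ := by
    rw [← integral_map (hmeas g) (by rw [hμ]; exact hφ.aestronglyMeasurable), hμ]
  refine ⟨integrable_finsetSum _ fun k _ => hint (x k), ?_⟩
  rw [integral_finsetSum _ fun k _ => hint (x k)]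
  simp only [heq, Finset.sum_const, Finset.card_range, nsmul_eq_mul]
  rw [inv_mul_cancel_left₀ (Nat.cast_ne_zero.2 hn.ne')]

/-- For every smooth `φ : 𝕋_P → ℂ` there is a constant `C_φ > 0` such
that for every `n ≥ 1` coprime to all primes of `P`,
`|n⁻¹ ∑_{k=0}^{n−1} φ(Δ(k/n)) − ∫_{𝕋_P} φ dm| ≤ C_φ/n`:
the rational points `{Δ(k/n) : 0 ≤ k < n}` equidistribute in `𝕋_P` with rate `1/n`. -/
theorem rational_points_equidistribute_in_solenoid
    (mT : Measure (TP P)) (hmTprob : IsProbabilityMeasure mT)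
    (hmTinv : ∀ t : TP P, Measure.map (fun s => t + s) mT = mT)
    (φ : TP P → ℂ) (hφ : IsSmoothTP P φ) :
    ∃ C : ℝ, 0 < C ∧
      ∀ n : ℕ, 0 < n → (∀ p ∈ P, Nat.gcd n p = 1) →
        ‖(n : ℂ)⁻¹ *
            (∑ k ∈ Finset.range n,
              φ (QuotientAddGroup.mk (ratDiag P ((k : ℚ) / (n : ℚ))))) -
          ∫ t, φ t ∂mT‖ ≤ C / (n : ℝ) := by
  obtain ⟨⟨m, hinv⟩, hsmooth, hcont⟩ := hφ
  have hprime (p : ↥P) : (p : ℕ).Prime := Fact.out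
  set N : ℕ := ∏ q : ↥P, (q : ℕ) ^ m q
  have hN0 : 0 < N := Finset.prod_pos fun q _ => pow_pos (hprime q).pos _
  have hN (p : ↥P) : (p : ℕ) ^ m p ∣ N :=
    Finset.dvd_prod_of_mem (fun q : ↥P => (q : ℕ) ^ m q) (Finset.mem_univ p)
  have hφcont : Continuous φ := by
    have hι : iotaR P 0 = 0 := rfl
    simpa [hι] using hcont 0
  have hf : ContDiff ℝ 1 fun s : ℝ => φ (iotaR P s) := by
    simpa using (hsmooth 0).of_le (m := 1) (by exact_mod_cast le_top)
  obtain ⟨B, hB, hbound, hlip⟩ := exists_bound_and_lipschitz_of_periodic hf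
    (Nat.cast_ne_zero.2 hN0.ne') (periodic_apply_iotaR hinv hN)
  have hφint : Integrable φ mT := by
    refine Integrable.of_bound
      (measurable_of_continuous_TP P hφcont).aestronglyMeasurable B (.of_forall fun t => ?_)
    obtain ⟨y, hy⟩ := exists_forall_apply_add_eq hinv t
    have h := hy 0
    rw [zero_add, zero_add] at h
    rw [h]
    exact hbound y
  refine ⟨B * N + 1, by positivity, fun n hn hcop => ?_⟩
  obtain ⟨hsumint, heq⟩ := integral_eq_integral_average hmTinv hφint hn
    (fun k => QuotientAddGroup.mk (ratDiag P ((k : ℚ) / (n : ℚ))))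
  set S : ℂ := ∑ k ∈ Finset.range n, φ (QuotientAddGroup.mk (ratDiag P ((k : ℚ) / (n : ℚ))))
  have hS : S = ∫ _, S ∂mT := by simp
  rw [heq, ← mul_sub, norm_mul, norm_inv, Complex.norm_natCast, div_eq_inv_mul, hS,
    ← integral_sub (integrable_const S) hsumint]
  refine mul_le_mul_of_nonneg_left ?_ (by positivity)
  refine (norm_integral_le_of_norm_le_const (C := B * N) (.of_forall fun t =>
    norm_sum_sub_sum_translate_le hinv hN hN0 hB hlip hn hcop t)).trans ?_
  simp

end
end

section
/- Let t, s ∈ ℝ and y > 0. Then the matrix u_t · a_y · v_{−s} has integer entries (equivalently, lies in SL₂(ℤ)) if and only if there exist n ∈ ℕ+ and k, l ∈ ℤ such that y = 1/n, t = k/n, s = l/n and k·l ≡ 1 (mod n). Consequently, the expanding horocycle orbit SL₂(ℤ)·U·a_y in SL₂(ℤ)\SL₂(ℝ) meets the orbit SL₂(ℤ)·V exactly when y = 1/n for some n ∈ ℕ+, and the intersection points correspond to pairs (k/n, l/n) with k·l ≡ 1 (mod n). -/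
/-- The product `u_t · a_y · v_{−s}` written as a single matrix. -/
lemma upper_mul_diag_mul_lower {K : Type*} [Field K] (t s y : K) :
    (!![1, t; 0, 1] * !![y, 0; 0, y⁻¹] * !![1, 0; -s, 1] : Matrix (Fin 2) (Fin 2) K) =
      !![y - t * y⁻¹ * s, t * y⁻¹; -(y⁻¹ * s), y⁻¹] := by
  simp [sub_eq_add_neg]

/-- Let `t, s ∈ ℝ` and `y > 0`.  The matrix `u_t · a_y · v_{−s}` has
integer entries (equivalently, lies in `SL₂(ℤ)`) if and only if there exist `n ∈ ℕ+` and
`k, l ∈ ℤ` with `y = 1/n`, `t = k/n`, `s = l/n` and `k·l ≡ 1 (mod n)`.  Here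
`u_t = [[1,t],[0,1]]`, `a_y = [[y,0],[0,1/y]]`, `v_t = [[1,0],[t,1]]`. -/
theorem horocycle_intersection_iff (t s y : ℝ) (hy : 0 < y) :
    (∀ i j : Fin 2,
        ∃ z : ℤ,
          ((!![1, t; 0, 1] * !![y, 0; 0, y⁻¹] * !![1, 0; -s, 1]) :
              Matrix (Fin 2) (Fin 2) ℝ) i j = (z : ℝ)) ↔
      ∃ (n : ℕ+) (k l : ℤ),
        y = 1 / ((n : ℕ) : ℝ) ∧ t = (k : ℝ) / ((n : ℕ) : ℝ) ∧ s = (l : ℝ) / ((n : ℕ) : ℝ) ∧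
          k * l ≡ 1 [ZMOD ((n : ℕ) : ℤ)] := by
  simp only [upper_mul_diag_mul_lower, Fin.forall_fin_two, Matrix.of_apply, Matrix.cons_val',
    Matrix.cons_val_zero, Matrix.cons_val_one, Matrix.cons_val_fin_one]
  constructor
  · rintro ⟨⟨⟨a, ha⟩, k, hk⟩, ⟨c, hc⟩, d, hd⟩
    have hd_pos : 0 < d := by exact_mod_cast hd ▸ inv_pos.mpr hy
    lift d to ℕ using hd_pos.le
    have hd' : y⁻¹ = (d : ℝ) := by exact_mod_cast hd
    have hd0 : (d : ℝ) ≠ 0 := hd' ▸ inv_ne_zero hy.ne'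
    have hy' : y = 1 / (d : ℝ) := by rw [← hd', one_div, inv_inv]
    rw [hd'] at hk hc ha
    refine ⟨⟨d, by exact_mod_cast hd_pos⟩, k, -c, hy', ?_, ?_, ?_⟩
    · rw [PNat.mk_coe, eq_div_iff hd0, hk]
    · rw [PNat.mk_coe, eq_div_iff hd0]
      push_cast
      linear_combination -hc
    · refine Int.modEq_iff_dvd.mpr ⟨a, ?_⟩
      have h : (1 : ℝ) - k * -c = d * a := by
        rw [← ha, ← hk, ← hc, hy']
        field_simp
      exact_mod_cast h
  · rintro ⟨n, k, l, rfl, rfl, rfl, h⟩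
    obtain ⟨a, ha⟩ := Int.modEq_iff_dvd.mp h
    have ha' : (1 : ℝ) - k * l = (n : ℕ) * a := by exact_mod_cast ha
    have hn : ((n : ℕ) : ℝ) ≠ 0 := by exact_mod_cast n.ne_zero
    refine ⟨⟨⟨a, ?_⟩, k, ?_⟩, ⟨-l, ?_⟩, ((n : ℕ) : ℤ), ?_⟩
    · field_simp
      linear_combination ha'
    · field_simp
    · push_cast
      field_simp
    · simp
end
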